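/- Let R be the valuation ring of a finite extension K of ℚ_p, with maximal ideal 𝔭 = πR and residue field k, let G be a finite group, and let Λ be an R-order in K[G] (an R-subalgebra, finitely generated as an R-module, spanning K[G] over K). Let E₁ and E₂ be Λ-lattices spanning the same K-vector space, i.e. finitely generated R-torsion-free left Λ-modules inside a common K[G]-module V with K·E₁ = K·E₂ = V. Then the finite-length Λ-modules E₁/πE₁ and E₂/πE₂ have the same composition factors: any composition series of E₁/πE₁ and any composition series of E₂/πE₂ are Jordan–Hölder equivalent, i.e. have the same multiset of isomorphism classes of simple factors. -/

import Mathlib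

noncomputable section

set_option linter.unusedSectionVars false
set_option maxHeartbeats 1000000
set_option synthInstance.maxHeartbeats 800000

open scoped BigOperators

/-- Multiplication by `π ∈ R` on a module `E` with commuting `R`- and `Λ`-actions, as a
`Λ`-linear endomorphism; its range is the submodule `πE`. -/
def piMulMap (R : Type) [CommRing R] (Λ : Type) [Ring Λ] (π : R)
    (E : Type) [AddCommGroup E] [Module R E] [Module Λ E] [SMulCommClass R Λ E] :
    E →ₗ[Λ] E where
  toFun x := π • x
  map_add' x y := smul_add π x y
  map_smul' u x := (smul_comm π u x)

/-- The `i`-th composition factor of a chain of `Λ`-submodules. -/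
abbrev chainFactor {Λ : Type} [Ring Λ] {M : Type} [AddCommGroup M] [Module Λ M]
    {n : ℕ} (s : Fin (n + 1) → Submodule Λ M) (i : Fin n) :=
  (s i.succ) ⧸ (Submodule.comap (s i.succ).subtype (s i.castSucc))

/-- A composition series of `Λ`-submodules from `⊥` to `⊤` with simple factors. -/
def IsCompSeries {Λ : Type} [Ring Λ] {M : Type} [AddCommGroup M] [Module Λ M]
    {n : ℕ} (s : Fin (n + 1) → Submodule Λ M) : Prop :=
  s 0 = ⊥ ∧ s (Fin.last n) = ⊤ ∧
    ∀ i : Fin n, s i.castSucc ≤ s i.succ ∧ IsSimpleModule Λ (chainFactor s i)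

open CategoryTheory in
/-- The isomorphism class of the subquotient `B / (A ∩ B)`. -/
def factorClass {Λ : Type} [Ring Λ] {M : Type} [AddCommGroup M] [Module Λ M]
    (A B : Submodule Λ M) : Quotient (isIsomorphicSetoid (ModuleCat.{0} Λ)) :=
  Quotient.mk _ (ModuleCat.of Λ (B ⧸ A.comap B.subtype))

section Factors

variable {Λ : Type} [Ring Λ] {M N : Type} [AddCommGroup M] [Module Λ M]
  [AddCommGroup N] [Module Λ N]

theorem factorClass_eq_iff {A B : Submodule Λ M} {C D : Submodule Λ N} :
    factorClass A B = factorClass C D ↔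
      Nonempty ((B ⧸ A.comap B.subtype) ≃ₗ[Λ] (D ⧸ C.comap D.subtype)) := by
  refine ⟨fun h => ?_, fun ⟨e⟩ => Quotient.sound ⟨e.toModuleIso⟩⟩
  obtain ⟨e⟩ := Quotient.exact h
  exact ⟨e.toLinearEquiv⟩

theorem factorClass_map {f : M →ₗ[Λ] N} (hf : Function.Injective f) (A B : Submodule Λ M) :
    factorClass (A.map f) (B.map f) = factorClass A B := by
  refine factorClass_eq_iff.2 ⟨(Submodule.Quotient.equiv _ _
    (Submodule.equivMapOfInjective f hf B) ?_).symm⟩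
  ext ⟨y, x, hx, rfl⟩
  constructor
  · rintro ⟨z, hz, h⟩
    exact ⟨z, hz, congrArg Subtype.val h⟩
  · rintro ⟨z, hz, h⟩
    obtain rfl := hf h
    exact ⟨⟨z, hx⟩, hz, rfl⟩

theorem factorClass_comap {f : M →ₗ[Λ] N} (hf : Function.Surjective f) (A B : Submodule Λ N) :
    factorClass (A.comap f) (B.comap f) = factorClass A B := by
  let g : B.comap f →ₗ[Λ] B := f.restrict fun _ hx => hx
  have hg : Function.Surjective g := by
    rintro ⟨y, hy⟩
    obtain ⟨x, rfl⟩ := hf y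
    exact ⟨⟨x, hy⟩, rfl⟩
  have hker : (A.comap f).comap (B.comap f).subtype =
      LinearMap.ker ((A.comap B.subtype).mkQ ∘ₗ g) := by
    ext x
    simp [g, LinearMap.restrict_apply]
  exact factorClass_eq_iff.2 ⟨(Submodule.quotEquivOfEq _ _ hker).trans
    (LinearMap.quotKerEquivOfSurjective _ ((Submodule.mkQ_surjective _).comp hg))⟩

theorem covBy_of_factorClass_eq {A B : Submodule Λ M} {C D : Submodule Λ N}
    (h : factorClass A B = factorClass C D) (hAB : A ≤ B) (hCD : C ⋖ D) : A ⋖ B := by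
  obtain ⟨e⟩ := factorClass_eq_iff.1 h
  have := (covBy_iff_quot_is_simple hCD.le).1 hCD
  exact (covBy_iff_quot_is_simple hAB).2 (IsSimpleModule.congr e)

/-- The multiset of isomorphism classes of factors of a composition series. -/
def factors (s : CompositionSeries (Submodule Λ M)) :
    Multiset (Quotient (CategoryTheory.isIsomorphicSetoid (ModuleCat.{0} Λ))) :=
  ∑ i : Fin s.length, {factorClass (s i.castSucc) (s i.succ)}

theorem factors_eq_of_equivalent {s t : CompositionSeries (Submodule Λ M)}
    (h : s.Equivalent t) : factors s = factors t := by
  obtain ⟨e, he⟩ := h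
  refine Fintype.sum_equiv e _ _ fun i => ?_
  rw [factorClass_eq_iff.2 ⟨(he i).linearEquiv⟩]

theorem factors_smash {s t : CompositionSeries (Submodule Λ M)} (h : s.last = t.head) :
    factors (s.smash t h) = factors s + factors t := by
  refine (Fin.sum_univ_add (a := s.length) (b := t.length) _).trans ?_
  exact congrArg₂ (· + ·)
    (Finset.sum_congr rfl fun i _ => congrArg singleton (congrArg₂ factorClass
      (RelSeries.smash_castAdd h i) (RelSeries.smash_succ_castAdd h i)))
    (Finset.sum_congr rfl fun i _ => congrArg singleton (congrArg₂ factorClass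
      (RelSeries.smash_natAdd h i) (RelSeries.smash_succ_natAdd h i)))

/-- The image of a composition series under an injective linear map. -/
def mapSeries (f : M →ₗ[Λ] N) (hf : Function.Injective f)
    (s : CompositionSeries (Submodule Λ M)) : CompositionSeries (Submodule Λ N) where
  length := s.length
  toFun i := (s i).map f
  step i := covBy_of_factorClass_eq (factorClass_map hf _ _)
    (Submodule.map_mono (s.step i).le) (s.step i)

theorem factors_mapSeries {f : M →ₗ[Λ] N} (hf : Function.Injective f)
    (s : CompositionSeries (Submodule Λ M)) : factors (mapSeries f hf s) = factors s :=
  Finset.sum_congr rfl fun _ _ => congrArg _ (factorClass_map hf _ _)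

/-- The preimage of a composition series under a surjective linear map. -/
def comapSeries (f : M →ₗ[Λ] N) (hf : Function.Surjective f)
    (s : CompositionSeries (Submodule Λ N)) : CompositionSeries (Submodule Λ M) where
  length := s.length
  toFun i := (s i).comap f
  step i := covBy_of_factorClass_eq (factorClass_comap hf _ _)
    (Submodule.comap_mono (s.step i).le) (s.step i)

theorem factors_comapSeries {f : M →ₗ[Λ] N} (hf : Function.Surjective f)
    (s : CompositionSeries (Submodule Λ N)) : factors (comapSeries f hf s) = factors s :=
  Finset.sum_congr rfl fun _ _ => congrArg _ (factorClass_comap hf _ _)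

/-- Let `φ : N → M` and the endomorphisms `f` of `M` and `g` of `N` be injective, with
`φ ∘ g = f ∘ φ` and `M / φ(N)` of finite length. Then composition series of `M / f(M)` and
`N / g(N)` have the same factors. -/
theorem factors_eq_of_finite_length_coker {φ : N →ₗ[Λ] M} (hφ : Function.Injective φ)
    {f : M →ₗ[Λ] M} (hf : Function.Injective f) {g : N →ₗ[Λ] N} (hfg : φ ∘ₗ g = f ∘ₗ φ)
    (hfin : IsFiniteLength Λ (M ⧸ LinearMap.range φ))
    (s : CompositionSeries (Submodule Λ (M ⧸ LinearMap.range f)))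
    (hs₀ : s.head = ⊥) (hs₁ : s.last = ⊤)
    (t : CompositionSeries (Submodule Λ (N ⧸ LinearMap.range g)))
    (ht₀ : t.head = ⊥) (ht₁ : t.last = ⊤) : factors s = factors t := by
  obtain ⟨a, ha₀, ha₁⟩ := isFiniteLength_iff_exists_compositionSeries.1 hfin
  let s' := comapSeries _ (Submodule.mkQ_surjective _) s
  let a' := comapSeries _ (Submodule.mkQ_surjective _) a
  let t' := mapSeries φ hφ (comapSeries _ (Submodule.mkQ_surjective _) t)
  let b' := mapSeries f hf a'
  have hs₀' : s'.head = LinearMap.range f :=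
    (congrArg (Submodule.comap _) hs₀).trans (by simp)
  have hs₁' : s'.last = ⊤ := (congrArg (Submodule.comap _) hs₁).trans (by simp)
  have ha₀' : a'.head = LinearMap.range φ :=
    (congrArg (Submodule.comap _) ha₀).trans (by simp)
  have ha₁' : a'.last = ⊤ := (congrArg (Submodule.comap _) ha₁).trans (by simp)
  have hb₀' : b'.head = (LinearMap.range φ).map f := congrArg (Submodule.map f) ha₀'
  have hb₁' : b'.last = LinearMap.range f :=
    (congrArg (Submodule.map f) ha₁').trans (by simp)
  have ht₀' : t'.head = (LinearMap.range φ).map f :=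
    (congrArg (fun A => Submodule.map φ (Submodule.comap _ A)) ht₀).trans (by
      simp [← LinearMap.range_comp, hfg])
  have ht₁' : t'.last = LinearMap.range φ :=
    (congrArg (fun A => Submodule.map φ (Submodule.comap _ A)) ht₁).trans (by simp)
  have h := factors_eq_of_equivalent (CompositionSeries.jordan_holder
    (b'.smash s' (hb₁'.trans hs₀'.symm)) (t'.smash a' (ht₁'.trans ha₀'.symm))
    (by simp [hb₀', ht₀']) (by simp [hs₁', ha₁']))
  rw [factors_smash, factors_smash, add_comm (factors t')] at h
  simpa [b', s', t', factors_mapSeries, factors_comapSeries] using h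

/-- The composition series attached to a chain satisfying `IsCompSeries`. -/
def IsCompSeries.toSeries {n : ℕ} {s : Fin (n + 1) → Submodule Λ M} (hs : IsCompSeries s) :
    CompositionSeries (Submodule Λ M) where
  length := n
  toFun := s
  step i := (covBy_iff_quot_is_simple (hs.2.2 i).1).2 (hs.2.2 i).2

end Factors

theorem exists_equiv_of_sum_singleton_eq {ι κ α : Type*} [Fintype ι] [Fintype κ] {f : ι → α}
    {g : κ → α} (h : ∑ i, ({f i} : Multiset α) = ∑ j, {g j}) :
    ∃ e : ι ≃ κ, ∀ i, f i = g (e i) := by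
  classical
  have hcard (c : α) : Nonempty ({i // f i = c} ≃ {j // g j = c}) := by
    have := congrArg (Multiset.count c) h
    simp only [Multiset.count_sum', Multiset.count_singleton, Finset.sum_boole, Nat.cast_id,
      eq_comm (a := c)] at this
    exact Fintype.card_eq.1 (by simpa [Fintype.card_subtype] using this)
  refine ⟨(Equiv.sigmaFiberEquiv f).symm.trans ((Equiv.sigmaCongrRight
    fun c => (hcard c).some).trans (Equiv.sigmaFiberEquiv g)), fun i => ?_⟩
  exact ((hcard (f i)).some ⟨i, rfl⟩).2.symm

/-- A finite module over a Noetherian domain of dimension at most one that is killed by a nonzero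
scalar is Noetherian and Artinian. -/
theorem isNoetherian_and_isArtinian_of_smul_eq_zero {R M : Type*} [CommRing R] [IsDomain R]
    [IsNoetherianRing R] [Ring.KrullDimLE 1 R] [AddCommGroup M] [Module R M] [Module.Finite R M]
    {t : R} (ht : t ≠ 0) (h : ∀ x : M, t • x = 0) : IsNoetherian R M ∧ IsArtinian R M := by
  refine ⟨inferInstance, ?_⟩
  have htor : Module.IsTorsionBySet R M (Ideal.span {t} : Ideal R) := by
    rw [Module.isTorsionBySet_span_singleton_iff]
    exact fun x => h x
  let := htor.module
  have : IsScalarTower R (R ⧸ Ideal.span {t}) M := htor.isScalarTower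
  have : IsArtinian R (R ⧸ Ideal.span {t}) :=
    (isFiniteLength_iff_isNoetherian_isArtinian.1
      (isFiniteLength_quotient_span_singleton R (mem_nonZeroDivisors_of_ne_zero ht))).2
  have : IsArtinianRing (R ⧸ Ideal.span {t}) := isArtinian_of_tower R inferInstance
  have : Module.Finite (R ⧸ Ideal.span {t}) M := Module.Finite.of_restrictScalars_finite R _ M
  exact isArtinian_of_surjective_algebraMap (R := R ⧸ Ideal.span {t})
    Ideal.Quotient.mk_surjective

/-- Finitely many vectors in the span over the fraction field have a common denominator. -/
theorem exists_ne_zero_smul_mem {R K V : Type*} [CommRing R] [IsDomain R] [Field K] [Algebra R K]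
    [IsFractionRing R K] [AddCommGroup V] [Module K V] [Module R V] [IsScalarTower R K V]
    {L : Submodule R V} (hL : Submodule.span K (L : Set V) = ⊤) (E : Type*) [AddCommGroup E]
    [Module R E] [Module.Finite R E] (j : E →ₗ[R] V) : ∃ r : R, r ≠ 0 ∧ ∀ x, r • j x ∈ L := by
  have key (v : V) : ∃ r : R, r ≠ 0 ∧ r • v ∈ L := by
    have hv : v ∈ Submodule.span K (L : Set V) := hL ▸ Submodule.mem_top
    induction hv using Submodule.span_induction with
    | mem v hv => exact ⟨1, one_ne_zero, by simpa using hv⟩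
    | zero => exact ⟨1, one_ne_zero, by simp⟩
    | add v w _ _ hv hw =>
      obtain ⟨r, hr, hrv⟩ := hv
      obtain ⟨q, hq, hqw⟩ := hw
      refine ⟨r * q, mul_ne_zero hr hq, ?_⟩
      rw [smul_add, mul_comm, mul_smul, mul_comm, mul_smul]
      exact add_mem (L.smul_mem _ hrv) (L.smul_mem _ hqw)
    | smul c v _ hv =>
      obtain ⟨r, hr, hrv⟩ := hv
      obtain ⟨a, b, hb, rfl⟩ := IsFractionRing.div_surjective (A := R) c
      have hb0 : algebraMap R K b ≠ 0 :=
        IsFractionRing.to_map_ne_zero_of_mem_nonZeroDivisors hb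
      refine ⟨r * b, mul_ne_zero hr (nonZeroDivisors.ne_zero hb), ?_⟩
      have : (r * b) • (algebraMap R K a / algebraMap R K b) • v = a • r • v := by
        rw [← algebraMap_smul K, ← algebraMap_smul K a, ← algebraMap_smul K r v, smul_smul,
          smul_smul]
        congr 1
        simp only [map_mul]
        field_simp
      rw [this]
      exact L.smul_mem _ hrv
  obtain ⟨S, hS⟩ := Module.Finite.fg_top (R := R) (M := E)
  choose r hr hrL using fun x => key (j x)
  refine ⟨∏ x ∈ S, r x, Finset.prod_ne_zero_iff.2 fun x _ => hr x, fun x => ?_⟩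
  have hx : x ∈ Submodule.span R (S : Set E) := hS ▸ Submodule.mem_top
  induction hx using Submodule.span_induction with
  | mem x hx =>
    classical
    rw [← Finset.prod_erase_mul _ _ hx, mul_smul]
    exact L.smul_mem _ (hrL x)
  | zero => simp
  | add x y _ _ hx hy => simpa using add_mem hx hy
  | smul c x _ hx =>
    rw [map_smul, smul_comm]
    exact L.smul_mem _ hx

/-- Let `R` be the valuation ring of a finite extension `K` of `ℚ_p`,
with maximal ideal `πR`, `Λ` an `R`-order in `K[G]`, and `E₁, E₂` two `Λ`-lattices spanning
the same `K[G]`-module `V`.  Then the `Λ`-modules `E₁/πE₁` and `E₂/πE₂` have the same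
composition factors: any two composition series (of `E₁/πE₁` resp. `E₂/πE₂`) have the same
length and, after a permutation, isomorphic simple factors. -/
theorem statement6
    (p : ℕ) [Fact p.Prime]
    (K : Type) [Field K] [Algebra ℚ_[p] K] [FiniteDimensional ℚ_[p] K]
    (R : Type) [CommRing R] [IsDomain R] [IsLocalRing R] [Algebra R K] [IsFractionRing R K]
    [Algebra ℤ_[p] R] [Algebra ℤ_[p] K] [IsScalarTower ℤ_[p] R K] [IsIntegralClosure R ℤ_[p] K]
    (π : R) (hπ : IsLocalRing.maximalIdeal R = Ideal.span {π})
    (G : Type) [Group G] [Fintype G]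
    (Λ : Subalgebra R (MonoidAlgebra K G))
    (hfg : Λ.toSubmodule.FG)
    (hspan : Submodule.span K (Λ : Set (MonoidAlgebra K G)) = ⊤)
    (V : Type) [AddCommGroup V] [Module K V] [Module (MonoidAlgebra K G) V]
    [IsScalarTower K (MonoidAlgebra K G) V] [Module R V] [IsScalarTower R K V]
    (E₁ E₂ : Type) [AddCommGroup E₁] [AddCommGroup E₂]
    [Module R E₁] [Module R E₂] [Module Λ E₁] [Module Λ E₂]
    [IsScalarTower R Λ E₁] [IsScalarTower R Λ E₂]
    [SMulCommClass R Λ E₁] [SMulCommClass R Λ E₂]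
    [Module.Finite R E₁] [Module.Finite R E₂]
    (j₁ : E₁ →ₗ[R] V) (j₂ : E₂ →ₗ[R] V)
    (hj₁ : Function.Injective j₁) (hj₂ : Function.Injective j₂)
    (he₁ : ∀ (u : Λ) (x : E₁), j₁ (u • x) = (u : MonoidAlgebra K G) • j₁ x)
    (he₂ : ∀ (u : Λ) (x : E₂), j₂ (u • x) = (u : MonoidAlgebra K G) • j₂ x)
    (hs₁ : Submodule.span K (Set.range j₁) = ⊤)
    (hs₂ : Submodule.span K (Set.range j₂) = ⊤) :
    ∀ (n₁ n₂ : ℕ)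
      (s₁ : Fin (n₁ + 1) →
        Submodule Λ (E₁ ⧸ LinearMap.range (piMulMap R Λ π E₁)))
      (s₂ : Fin (n₂ + 1) →
        Submodule Λ (E₂ ⧸ LinearMap.range (piMulMap R Λ π E₂))),
      IsCompSeries s₁ → IsCompSeries s₂ →
      n₁ = n₂ ∧ ∃ e : Fin n₁ ≃ Fin n₂, ∀ i : Fin n₁,
        Nonempty ((chainFactor s₁ i) ≃ₗ[Λ] (chainFactor s₂ (e i))) := by
  intro n₁ n₂ s₁ s₂ h₁ h₂
  have : CharZero K := charZero_of_injective_algebraMap (algebraMap ℚ_[p] K).injective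
  have hinj : Function.Injective (algebraMap ℤ_[p] R) := by
    refine (injective_iff_map_eq_zero _).2 fun x hx => by_contra fun hx0 => ?_
    have hxK : algebraMap ℤ_[p] K x = 0 := by
      rw [IsScalarTower.algebraMap_apply ℤ_[p] R K, hx, map_zero]
    rw [PadicInt.unitCoeff_spec hx0, map_mul, map_pow, map_natCast] at hxK
    refine mul_ne_zero (((PadicInt.unitCoeff hx0).isUnit.map (algebraMap ℤ_[p] K)).ne_zero)
      (pow_ne_zero _ (Nat.cast_ne_zero.2 (Fact.out : p.Prime).ne_zero)) hxK
  have : Algebra.IsIntegral ℤ_[p] R := IsIntegralClosure.isIntegral_algebra ℤ_[p] K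
  have : Ring.DimensionLEOne R := .of_isIntegral ℤ_[p] R
  have hπ0 : π ≠ 0 := by
    rintro rfl
    rw [Ideal.span_singleton_eq_bot.2 rfl, ← IsLocalRing.isField_iff_maximalIdeal_eq] at hπ
    exact IsDiscreteValuationRing.not_isField ℤ_[p] (isField_of_isIntegral_of_isField hinj hπ)
  have : IsPrincipalIdealRing R := .of_prime_ne_bot fun P hP hP0 => by
    rw [IsLocalRing.eq_maximalIdeal (hP.isMaximal hP0), hπ]
    exact ⟨π, rfl⟩
  have hspan₁ : Submodule.span K (LinearMap.range j₁ : Set V) = ⊤ := by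
    rwa [LinearMap.coe_range]
  have hspan₂ : Submodule.span K (LinearMap.range j₂ : Set V) = ⊤ := by
    rwa [LinearMap.coe_range]
  obtain ⟨r, hr, hr₂⟩ := exists_ne_zero_smul_mem hspan₁ E₂ j₂
  obtain ⟨q, hq, hq₁⟩ := exists_ne_zero_smul_mem hspan₂ E₁ j₁
  have hsmul {a : R} (ha : a ≠ 0) : Function.Injective fun v : V => a • v := by
    have := Module.IsTorsionFree.trans_faithfulSMul R K V
    exact smul_right_injective V ha
  choose φ hφ using hr₂
  let Φ : E₂ →ₗ[Λ] E₁ :=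
    { toFun := φ
      map_add' := fun x y => hj₁ (by simp [hφ])
      map_smul' := fun u x => hj₁ (by
        rw [RingHom.id_apply, he₁, hφ, hφ, ← map_smul, ← map_smul, smul_comm, he₂]) }
  have hΦ : Function.Injective Φ := fun x y h => hj₂ (hsmul hr
    ((hφ x).symm.trans ((congrArg j₁ h).trans (hφ y))))
  have hpi : Function.Injective (piMulMap R Λ π E₁) := fun x y h => hj₁ (hsmul hπ0
    ((map_smul j₁ π x).symm.trans ((congrArg j₁ h).trans (map_smul j₁ π y))))
  have hcomm : Φ ∘ₗ piMulMap R Λ π E₂ = piMulMap R Λ π E₁ ∘ₗ Φ := by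
    ext x
    refine hj₁ ?_
    change j₁ (φ (π • x)) = j₁ (π • φ x)
    rw [hφ, map_smul, map_smul, hφ, smul_comm]
  have hfin : IsFiniteLength Λ (E₁ ⧸ LinearMap.range Φ) := by
    have : Module.Finite R (E₁ ⧸ LinearMap.range Φ) :=
      Module.Finite.of_surjective ((LinearMap.range Φ).mkQ.restrictScalars R)
        (Submodule.mkQ_surjective _)
    obtain ⟨hN, hA⟩ := isNoetherian_and_isArtinian_of_smul_eq_zero (M := E₁ ⧸ LinearMap.range Φ)
      (mul_ne_zero hr hq) fun y => by
        obtain ⟨y, rfl⟩ := Submodule.mkQ_surjective _ y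
        obtain ⟨x, hx⟩ := hq₁ y
        refine (Submodule.Quotient.mk_eq_zero _).2 ⟨x, hj₁ ?_⟩
        change j₁ (φ x) = j₁ ((r * q) • y)
        rw [hφ, hx, map_smul, mul_smul]
    exact isFiniteLength_iff_isNoetherian_isArtinian.2
      ⟨isNoetherian_of_tower R hN, isArtinian_of_tower R hA⟩
  have hfac := factors_eq_of_finite_length_coker hΦ hpi hcomm hfin
    h₁.toSeries h₁.1 h₁.2.1 h₂.toSeries h₂.1 h₂.2.1
  obtain ⟨e, he⟩ := exists_equiv_of_sum_singleton_eq hfac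
  exact ⟨Fin.equiv_iff_eq.1 ⟨e⟩, e, fun i => factorClass_eq_iff.1 (he i)⟩
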